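/- Let p ∈ (1, ∞). There exists C = C(p) > 0 such that for all nonnegative functions ω, η ∈ L¹ ∩ L^p(ℝ²₊) with x₂ω, x₂η ∈ L¹(ℝ²₊), one has |E(ω) − E(η)| ≤ C · ‖ω − η‖_{L¹}^{1/2} · ‖ω − η‖_{L^p}^{1/2} · ‖x₂(ω + η)‖_{L¹}^{1 − 1/p} · ‖ω + η‖_{L¹}^{1/p}, where E(ω) = (1/2) ∬ G(x, y) ω(x) ω(y) dx dy is the kinetic energy on the upper half-plane. -/

import Mathlib

open MeasureTheory Real Set

noncomputable def G (x y : ℝ × ℝ) : ℝ :=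
  (1 / (4 * π)) * Real.log (1 + 4 * x.2 * y.2 / ((x.1 - y.1)^2 + (x.2 - y.2)^2))

def upperHalf : Set (ℝ × ℝ) := {y : ℝ × ℝ | 0 < y.2}

noncomputable def energy (ω : ℝ × ℝ → ℝ) : ℝ :=
  (1/2) * ∫ x in upperHalf, ∫ y in upperHalf, G x y * ω x * ω y

lemma G_symm (x y : ℝ × ℝ) : G x y = G y x := by
  unfold G
  rw [show 4 * x.2 * y.2 = 4 * y.2 * x.2 by ring,
    show (x.1 - y.1) ^ 2 + (x.2 - y.2) ^ 2 = (y.1 - x.1) ^ 2 + (y.2 - x.2) ^ 2 by ring]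

lemma measurable_G : Measurable (fun z : (ℝ × ℝ) × (ℝ × ℝ) => G z.1 z.2) := by
  unfold G
  fun_prop

lemma measurableSet_upperHalf : MeasurableSet upperHalf :=
  measurableSet_lt measurable_const measurable_snd

lemma G_nonneg {x y : ℝ × ℝ} (hx : x ∈ upperHalf) (hy : y ∈ upperHalf) : 0 ≤ G x y := by
  have hx' : 0 < x.2 := hx
  have hy' : 0 < y.2 := hy
  unfold G
  have : 0 ≤ 4 * x.2 * y.2 / ((x.1 - y.1)^2 + (x.2 - y.2)^2) := by positivity
  exact mul_nonneg (by positivity) (Real.log_nonneg (by linarith))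

lemma log_one_add_le_rpow_div {a u : ℝ} (ha : 0 < a) (ha1 : a ≤ 1) (hu : 0 ≤ u) :
    Real.log (1 + u) ≤ u ^ a / a := by
  rw [le_div_iff₀ ha, mul_comm, ← Real.log_rpow (by linarith)]
  have h1 := Real.rpow_add_le_add_rpow zero_le_one hu ha.le ha1
  rw [Real.one_rpow] at h1
  have h2 := Real.log_le_sub_one_of_pos (Real.rpow_pos_of_pos (show 0 < 1 + u by linarith) a)
  linarith

lemma G_le_dist_rpow {a : ℝ} (ha : 0 < a) (ha1 : a ≤ 1) {x y : ℝ × ℝ}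
    (hx : x ∈ upperHalf) (hy : y ∈ upperHalf) :
    G x y ≤ 1 / a * x.2 ^ a * dist x y ^ (-a) := by
  have hx' : 0 < x.2 := hx
  have hy' : 0 < y.2 := hy
  rcases eq_or_ne x y with rfl | hxy
  · simp [G, Real.zero_rpow (neg_ne_zero.2 ha.ne')]
  have hd : 0 < dist x y := dist_pos.2 hxy
  set d := dist x y with hd_def
  have h1 : |x.1 - y.1| ≤ d := le_max_left _ _
  have h2 : |x.2 - y.2| ≤ d := le_max_right _ _
  have hsq : d ^ 2 ≤ (x.1 - y.1)^2 + (x.2 - y.2)^2 := by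
    rcases max_choice (dist x.1 y.1) (dist x.2 y.2) with h | h
    · have : d = |x.1 - y.1| := h
      rw [this, sq_abs]; nlinarith [sq_nonneg (x.2 - y.2)]
    · have : d = |x.2 - y.2| := h
      rw [this, sq_abs]; nlinarith [sq_nonneg (x.1 - y.1)]
  have hy2 : y.2 ≤ x.2 + d := by linarith [(abs_le.1 h2).1]
  set t := x.2 / d with ht
  have htpos : 0 < t := by positivity
  have hfrac : 1 + 4 * x.2 * y.2 / ((x.1 - y.1)^2 + (x.2 - y.2)^2) ≤ (1 + 2 * t) ^ 2 := by
    have : 4 * x.2 * y.2 / ((x.1 - y.1)^2 + (x.2 - y.2)^2) ≤ 4 * x.2 * (x.2 + d) / d ^ 2 := by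
      gcongr
    have h3 : 4 * x.2 * (x.2 + d) / d ^ 2 = 4 * t ^ 2 + 4 * t := by
      rw [ht]; field_simp
    nlinarith
  have hlog : Real.log (1 + 4 * x.2 * y.2 / ((x.1 - y.1)^2 + (x.2 - y.2)^2))
      ≤ 2 * ((2 * t) ^ a / a) := by
    calc _ ≤ Real.log ((1 + 2 * t) ^ 2) := Real.log_le_log (by positivity) hfrac
      _ = 2 * Real.log (1 + 2 * t) := by rw [Real.log_pow]; norm_num
      _ ≤ _ := by gcongr; exact log_one_add_le_rpow_div ha ha1 (by positivity)
  have h2t : (2 * t) ^ a ≤ 2 * t ^ a := by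
    rw [Real.mul_rpow (by norm_num) htpos.le]
    gcongr
    simpa using Real.rpow_le_rpow_of_exponent_le (one_le_two (α := ℝ)) ha1
  have hta : t ^ a = x.2 ^ a * d ^ (-a) := by
    rw [ht, Real.div_rpow hx'.le hd.le, Real.rpow_neg hd.le, div_eq_mul_inv]
  have hpi : 1 / (4 * π) ≤ 1 / 4 := by
    apply one_div_le_one_div_of_le (by norm_num)
    linarith [Real.pi_gt_three]
  unfold G
  calc _ ≤ 1 / 4 * (2 * ((2 * t ^ a) / a)) := by
        gcongr
        · exact Real.log_nonneg (by
            have : 0 ≤ 4 * x.2 * y.2 / ((x.1 - y.1)^2 + (x.2 - y.2)^2) := by positivity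
            linarith)
        · exact hlog.trans (by gcongr)
    _ = 1 / a * x.2 ^ a * d ^ (-a) := by rw [mul_assoc, ← hta]; ring

lemma integral_indicator_abs_rpow_neg_half {R : ℝ} (hR : 0 < R) :
    ∫ s : ℝ, (Iic R).indicator (fun u => u ^ (-(1 / 2) : ℝ)) |s| = 4 * √R := by
  rw [integral_comp_abs (f := (Iic R).indicator (fun u => u ^ (-(1 / 2) : ℝ))),
    setIntegral_indicator measurableSet_Iic, Ioi_inter_Iic,
    ← intervalIntegral.integral_of_le hR.le, integral_rpow (by norm_num)]
  rw [Real.zero_rpow (by norm_num), Real.sqrt_eq_rpow]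
  norm_num
  ring

lemma integrable_indicator_abs_rpow_neg_half {R : ℝ} (hR : 0 < R) :
    Integrable (fun s : ℝ => (Iic R).indicator (fun u => u ^ (-(1 / 2) : ℝ)) |s|) := by
  by_contra h
  have h1 := integral_indicator_abs_rpow_neg_half hR
  rw [integral_undef h] at h1
  have := Real.sqrt_pos.2 hR
  linarith

lemma indicator_ball_inv_dist_le {R : ℝ} {x y : ℝ × ℝ} (h1 : y.1 ≠ x.1) (h2 : y.2 ≠ x.2) :
    (Metric.ball x R).indicator (fun y => (dist x y)⁻¹) y ≤
      (Iic R).indicator (fun u => u ^ (-(1 / 2) : ℝ)) |y.1 - x.1| *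
        (Iic R).indicator (fun u => u ^ (-(1 / 2) : ℝ)) |y.2 - x.2| := by
  have p1 : 0 < |y.1 - x.1| := abs_pos.2 (sub_ne_zero.2 h1)
  have p2 : 0 < |y.2 - x.2| := abs_pos.2 (sub_ne_zero.2 h2)
  have d1 : |y.1 - x.1| ≤ dist x y := by rw [dist_comm]; exact le_max_left _ _
  have d2 : |y.2 - x.2| ≤ dist x y := by rw [dist_comm]; exact le_max_right _ _
  by_cases hy : y ∈ Metric.ball x R
  · have hlt : dist x y < R := by rw [dist_comm]; exact hy
    rw [indicator_of_mem hy, indicator_of_mem (show |y.1 - x.1| ∈ Iic R from (d1.trans hlt.le)),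
      indicator_of_mem (show |y.2 - x.2| ∈ Iic R from (d2.trans hlt.le))]
    have hd : 0 < dist x y := p1.trans_le d1
    have : (dist x y)⁻¹ = dist x y ^ (-(1 / 2) : ℝ) * dist x y ^ (-(1 / 2) : ℝ) := by
      rw [← Real.rpow_add hd, ← Real.rpow_neg_one]; norm_num
    rw [this]
    gcongr ?_ * ?_
    · exact Real.rpow_le_rpow_of_nonpos p1 d1 (by norm_num)
    · exact Real.rpow_le_rpow_of_nonpos p2 d2 (by norm_num)
  · rw [indicator_of_notMem hy]
    refine mul_nonneg ?_ ?_ <;>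
    exact indicator_apply_nonneg fun _ => Real.rpow_nonneg (abs_nonneg _) _

lemma integrableOn_ball_inv_dist_and_integral_le (x : ℝ × ℝ) {R : ℝ} (hR : 0 < R) :
    IntegrableOn (fun y => (dist x y)⁻¹) (Metric.ball x R) ∧
      ∫ y in Metric.ball x R, (dist x y)⁻¹ ≤ 16 * R := by
  have hT := integrable_indicator_abs_rpow_neg_half hR
  have hI := integral_indicator_abs_rpow_neg_half hR
  have hprod := (hT.comp_sub_right x.1).mul_prod (hT.comp_sub_right x.2)
  rw [← Measure.volume_eq_prod] at hprod
  have hval := integral_prod_mul (μ := volume) (ν := volume)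
    (fun s : ℝ => (Iic R).indicator (fun u => u ^ (-(1 / 2) : ℝ)) |s - x.1|)
    (fun s : ℝ => (Iic R).indicator (fun u => u ^ (-(1 / 2) : ℝ)) |s - x.2|)
  rw [← Measure.volume_eq_prod,
    integral_sub_right_eq_self (fun s : ℝ => (Iic R).indicator (fun u => u ^ (-(1 / 2) : ℝ)) |s|),
    integral_sub_right_eq_self (fun s : ℝ => (Iic R).indicator (fun u => u ^ (-(1 / 2) : ℝ)) |s|),
    hI] at hval
  have hle : ∀ᵐ y : ℝ × ℝ, (Metric.ball x R).indicator (fun y => (dist x y)⁻¹) y ≤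
      (Iic R).indicator (fun u => u ^ (-(1 / 2) : ℝ)) |y.1 - x.1| *
        (Iic R).indicator (fun u => u ^ (-(1 / 2) : ℝ)) |y.2 - x.2| := by
    have e1 : ∀ᵐ y : ℝ × ℝ, y.1 ≠ x.1 := by
      rw [Measure.volume_eq_prod]
      exact Measure.quasiMeasurePreserving_fst.ae (volume.ae_ne x.1)
    have e2 : ∀ᵐ y : ℝ × ℝ, y.2 ≠ x.2 := by
      rw [Measure.volume_eq_prod]
      exact Measure.quasiMeasurePreserving_snd.ae (volume.ae_ne x.2)
    filter_upwards [e1, e2] with y h1 h2 using indicator_ball_inv_dist_le h1 h2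
  have hnn : ∀ y, 0 ≤ (Metric.ball x R).indicator (fun y => (dist x y)⁻¹) y := fun y =>
    indicator_apply_nonneg fun _ => inv_nonneg.2 dist_nonneg
  have hint : Integrable ((Metric.ball x R).indicator (fun y => (dist x y)⁻¹)) := by
    refine hprod.mono' ?_ ?_
    · exact (Measurable.indicator (by fun_prop) Metric.isOpen_ball.measurableSet).aestronglyMeasurable
    · filter_upwards [hle] with y hy
      rwa [Real.norm_of_nonneg (hnn y)]
  refine ⟨(integrable_indicator_iff Metric.isOpen_ball.measurableSet).1 hint, ?_⟩
  rw [← integral_indicator Metric.isOpen_ball.measurableSet]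
  refine (integral_mono_ae hint hprod hle).trans ?_
  rw [hval]
  nlinarith [Real.mul_self_sqrt hR.le]

lemma le_two_mul_sqrt_mul_sqrt {I A B : ℝ} (hI : 0 ≤ I) (hA : 0 ≤ A) (hB : 0 ≤ B)
    (h : ∀ s : ℝ, 0 < s → I ≤ A * s + B / s) : I ≤ 2 * √A * √B := by
  have hd : discrim A (-I) B ≤ 0 := by
    refine discrim_le_zero fun s => ?_
    rcases le_or_gt s 0 with hs | hs
    · nlinarith [mul_nonneg hA (mul_self_nonneg s), mul_nonneg hI (neg_nonneg.2 hs)]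
    · have h1 := mul_le_mul_of_nonneg_right (h s hs) hs.le
      rw [add_mul, div_mul_cancel₀ _ hs.ne'] at h1
      linarith
  rw [discrim] at hd
  refine abs_le_of_sq_le_sq' ?_ (by positivity) |>.2
  rw [mul_pow, mul_pow, Real.sq_sqrt hA, Real.sq_sqrt hB]
  linarith

lemma riesz_potential_bound {p : ℝ} (hp : 1 < p) {μ : Measure (ℝ × ℝ)} (hμ : μ ≤ volume)
    {g : ℝ × ℝ → ℝ} (hg : Integrable g μ) (hgp : Integrable (fun y => |g y| ^ p) μ) (x : ℝ × ℝ) :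
    Integrable (fun y => dist x y ^ (-(1 - 1 / p)) * |g y|) μ ∧
      ∫ y, dist x y ^ (-(1 - 1 / p)) * |g y| ∂μ ≤
        8 * √(∫ y, |g y| ∂μ) * √((∫ y, |g y| ^ p ∂μ) ^ (1 / p)) := by
  have hp0 : 0 < p := by linarith
  set a : ℝ := 1 - 1 / p with ha_def
  have h1p : 1 / p < 1 := by rw [div_lt_one hp0]; exact hp
  have ha : 0 < a := by linarith
  have ha1 : a < 1 := by have : 0 < 1 / p := by positivity
                         linarith
  have hq : (1 / a).HolderConjugate p := by
    rw [Real.holderConjugate_iff]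
    refine ⟨by rw [lt_div_iff₀ ha]; linarith, ?_⟩
    rw [one_div, inv_inv, ha_def, one_div]; ring
  set A := (∫ y, |g y| ^ p ∂μ) ^ (1 / p) with hA_def
  set B := ∫ y, |g y| ∂μ with hB_def
  have hA : 0 ≤ A := Real.rpow_nonneg (integral_nonneg fun y => Real.rpow_nonneg (abs_nonneg _) _) _
  have hB : 0 ≤ B := integral_nonneg fun y => abs_nonneg _
  have key : ∀ R : ℝ, 0 < R → Integrable (fun y => dist x y ^ (-a) * |g y|) μ ∧
      ∫ y, dist x y ^ (-a) * |g y| ∂μ ≤ (16 * R) ^ a * A + R ^ (-a) * B := by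
    intro R hR
    obtain ⟨hb1, hb2⟩ := integrableOn_ball_inv_dist_and_integral_le x hR
    have hball : MeasurableSet (Metric.ball x R) := Metric.isOpen_ball.measurableSet
    have hres : μ.restrict (Metric.ball x R) ≤ volume.restrict (Metric.ball x R) :=
      Measure.restrict_mono subset_rfl hμ
    have hpow : ∀ y, (dist x y ^ (-a)) ^ (1 / a) = (dist x y)⁻¹ := fun y => by
      rw [← Real.rpow_mul dist_nonneg, ← Real.rpow_neg_one]
      congr 1; field_simp
    set ν := μ.restrict (Metric.ball x R)
    have hmf : AEStronglyMeasurable (fun y => dist x y ^ (-a)) ν :=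
      Measurable.aestronglyMeasurable (by fun_prop)
    have hf : MemLp (fun y => dist x y ^ (-a)) (ENNReal.ofReal (1 / a)) ν := by
      rw [← integrable_norm_rpow_iff hmf (by simp [ha]) (by simp),
        ENNReal.toReal_ofReal (by positivity)]
      refine (Integrable.mono_measure hb1 hres).congr (.of_forall fun y => ?_)
      simp only
      rw [Real.norm_of_nonneg (Real.rpow_nonneg dist_nonneg _), hpow]
    have hgν : MemLp (fun y => |g y|) (ENNReal.ofReal p) ν := by
      rw [← integrable_norm_rpow_iff hg.abs.aestronglyMeasurable.restrict (by simp [hp0]) (by simp),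
        ENNReal.toReal_ofReal hp0.le]
      simpa using hgp.restrict
    have : (ENNReal.ofReal (1 / a)).HolderTriple (ENNReal.ofReal p) 1 := by
      have := hq.ennrealOfReal
      exact this
    have hnear : IntegrableOn (fun y => dist x y ^ (-a) * |g y|) (Metric.ball x R) μ :=
      hf.integrable_mul hgν
    have hfarle : ∀ y ∈ (Metric.ball x R)ᶜ, dist x y ^ (-a) * |g y| ≤ R ^ (-a) * |g y| := by
      intro y hy
      have : R ≤ dist x y := by rw [dist_comm]; simpa using hy
      gcongr ?_ * _
      exact Real.rpow_le_rpow_of_nonpos hR this (by linarith)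
    have hfar : IntegrableOn (fun y => dist x y ^ (-a) * |g y|) (Metric.ball x R)ᶜ μ := by
      refine (hg.abs.restrict.const_mul (R ^ (-a))).mono' ?_ ?_
      · exact (Measurable.aestronglyMeasurable (by fun_prop)).mul
          hg.abs.aestronglyMeasurable.restrict
      · filter_upwards [ae_restrict_mem hball.compl] with y hy
        rw [Real.norm_of_nonneg (mul_nonneg (Real.rpow_nonneg dist_nonneg _) (abs_nonneg _))]
        exact hfarle y hy
    have hint : Integrable (fun y => dist x y ^ (-a) * |g y|) μ := by
      rw [← integrableOn_univ, ← union_compl_self (Metric.ball x R)]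
      exact hnear.union hfar
    refine ⟨hint, ?_⟩
    rw [← integral_add_compl hball hint]
    gcongr ?_ + ?_
    · refine (integral_mul_le_Lp_mul_Lq_of_nonneg hq
        (.of_forall fun y => Real.rpow_nonneg dist_nonneg _)
        (.of_forall fun y => abs_nonneg _) hf hgν).trans ?_
      simp only [hpow]
      rw [one_div_one_div]
      have i1 : ∫ y, (dist x y)⁻¹ ∂ν ≤ 16 * R :=
        (integral_mono_measure hres (.of_forall fun y => inv_nonneg.2 dist_nonneg) hb1).trans hb2
      have i0 : 0 ≤ ∫ y, (dist x y)⁻¹ ∂ν := integral_nonneg fun y => inv_nonneg.2 dist_nonneg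
      have i2 : ∫ y, |g y| ^ p ∂ν ≤ ∫ y, |g y| ^ p ∂μ :=
        setIntegral_le_integral hgp (.of_forall fun y => Real.rpow_nonneg (abs_nonneg _) _)
      have i3 : 0 ≤ ∫ y, |g y| ^ p ∂ν :=
        integral_nonneg fun y => Real.rpow_nonneg (abs_nonneg _) _
      rw [hA_def]
      gcongr
    · refine (setIntegral_mono_on hfar (hg.abs.restrict.const_mul (R ^ (-a)))
        hball.compl hfarle).trans ?_
      rw [integral_const_mul]
      gcongr
      exact setIntegral_le_integral hg.abs (.of_forall fun y => abs_nonneg _)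
  refine ⟨(key 1 one_pos).1, ?_⟩
  have h16 : (16 : ℝ) ^ a ≤ 16 := by
    simpa using Real.rpow_le_rpow_of_exponent_le (show (1 : ℝ) ≤ 16 by norm_num) ha1.le
  have hopt := le_two_mul_sqrt_mul_sqrt (I := ∫ y, dist x y ^ (-a) * |g y| ∂μ)
    (A := 16 * A) (B := B)
    (integral_nonneg fun y => mul_nonneg (Real.rpow_nonneg dist_nonneg _) (abs_nonneg _))
    (by positivity) hB (fun s hs => by
      have hR := (key (s ^ (1 / a)) (by positivity)).2
      have hsa : (s ^ (1 / a)) ^ a = s := by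
        rw [← Real.rpow_mul hs.le, one_div_mul_cancel ha.ne', Real.rpow_one]
      rw [Real.mul_rpow (by norm_num) (by positivity), Real.rpow_neg (by positivity), hsa] at hR
      refine hR.trans ?_
      rw [inv_mul_eq_div]
      gcongr ?_ + _
      calc _ ≤ 16 * s * A := by gcongr
        _ = _ := by ring)
  refine hopt.trans (le_of_eq ?_)
  rw [Real.sqrt_mul (by norm_num), show √(16 : ℝ) = 4 by
    rw [show (16 : ℝ) = 4 ^ 2 by norm_num]; exact Real.sqrt_sq (by norm_num)]
  ring

lemma rpow_moment_bound {p : ℝ} (hp : 1 < p) {f : ℝ × ℝ → ℝ} (hf0 : ∀ y, 0 ≤ f y)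
    (hf : IntegrableOn f upperHalf) (hf2 : IntegrableOn (fun y => y.2 * f y) upperHalf) :
    IntegrableOn (fun y => y.2 ^ (1 - 1 / p) * f y) upperHalf ∧
      ∫ y in upperHalf, y.2 ^ (1 - 1 / p) * f y ≤
        (∫ y in upperHalf, y.2 * f y) ^ (1 - 1 / p) * (∫ y in upperHalf, f y) ^ (1 / p) := by
  have hp0 : 0 < p := by linarith
  set a : ℝ := 1 - 1 / p with ha_def
  have h1p : 1 / p < 1 := by rw [div_lt_one hp0]; exact hp
  have ha : 0 < a := by linarith
  have hq : (1 / a).HolderConjugate p := by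
    rw [Real.holderConjugate_iff]
    have : 0 < 1 / p := by positivity
    refine ⟨by rw [lt_div_iff₀ ha]; linarith, ?_⟩
    rw [one_div, inv_inv, ha_def, one_div]; ring
  have hpos : ∀ᵐ y ∂(volume.restrict upperHalf), 0 < y.2 :=
    ae_restrict_mem measurableSet_upperHalf
  have e1 : ∀ᵐ y ∂(volume.restrict upperHalf),
      ((y.2 * f y) ^ a) ^ (1 / a) = y.2 * f y := by
    filter_upwards [hpos] with y hy
    rw [← Real.rpow_mul (mul_nonneg hy.le (hf0 y)), mul_one_div_cancel ha.ne', Real.rpow_one]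
  have e2 : ∀ y, (f y ^ (1 / p)) ^ p = f y := fun y => by
    rw [← Real.rpow_mul (hf0 y), one_div_mul_cancel hp0.ne', Real.rpow_one]
  have e3 : ∀ᵐ y ∂(volume.restrict upperHalf),
      (y.2 * f y) ^ a * f y ^ (1 / p) = y.2 ^ a * f y := by
    filter_upwards [hpos] with y hy
    rw [Real.mul_rpow hy.le (hf0 y), mul_assoc, ← Real.rpow_add_of_nonneg (hf0 y) ha.le
      (by positivity), ha_def, sub_add_cancel, Real.rpow_one]
  have m1 : AEStronglyMeasurable (fun y : ℝ × ℝ => (y.2 * f y) ^ a)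
      (volume.restrict upperHalf) :=
    (hf2.aestronglyMeasurable.aemeasurable.pow_const a).aestronglyMeasurable
  have m2 : AEStronglyMeasurable (fun y : ℝ × ℝ => f y ^ (1 / p))
      (volume.restrict upperHalf) :=
    (hf.aestronglyMeasurable.aemeasurable.pow_const _).aestronglyMeasurable
  have l1 : MemLp (fun y : ℝ × ℝ => (y.2 * f y) ^ a) (ENNReal.ofReal (1 / a))
      (volume.restrict upperHalf) := by
    rw [← integrable_norm_rpow_iff m1 (by simp [ha]) (by simp),
      ENNReal.toReal_ofReal (by positivity)]
    refine Integrable.congr hf2 ?_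
    filter_upwards [e1, hpos] with y hy hy2
    rw [Real.norm_of_nonneg (Real.rpow_nonneg (mul_nonneg hy2.le (hf0 y)) _), hy]
  have l2 : MemLp (fun y : ℝ × ℝ => f y ^ (1 / p)) (ENNReal.ofReal p)
      (volume.restrict upperHalf) := by
    rw [← integrable_norm_rpow_iff m2 (by simp [hp0]) (by simp),
      ENNReal.toReal_ofReal hp0.le]
    refine Integrable.congr hf (.of_forall fun y => ?_)
    simp only
    rw [Real.norm_of_nonneg (Real.rpow_nonneg (hf0 y) _), e2]
  have : (ENNReal.ofReal (1 / a)).HolderTriple (ENNReal.ofReal p) 1 := hq.ennrealOfReal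
  refine ⟨Integrable.congr (l1.integrable_mul l2) e3, ?_⟩
  rw [← integral_congr_ae e3]
  refine (integral_mul_le_Lp_mul_Lq_of_nonneg hq ?_ ?_ l1 l2).trans (le_of_eq ?_)
  · filter_upwards [hpos] with y hy using Real.rpow_nonneg (mul_nonneg hy.le (hf0 y)) _
  · exact .of_forall fun y => Real.rpow_nonneg (hf0 y) _
  · rw [integral_congr_ae e1, one_div_one_div]
    simp only [e2]

lemma bilinear_energy_bound {p : ℝ} (hp : 1 < p) {f g : ℝ × ℝ → ℝ} (hf0 : ∀ y, 0 ≤ f y)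
    (hf : IntegrableOn f upperHalf) (hf2 : IntegrableOn (fun y => y.2 * f y) upperHalf)
    (hg : IntegrableOn g upperHalf) (hgp : IntegrableOn (fun y => |g y| ^ p) upperHalf) :
    Integrable (fun z : (ℝ × ℝ) × (ℝ × ℝ) => G z.1 z.2 * f z.1 * g z.2)
        ((volume.restrict upperHalf).prod (volume.restrict upperHalf)) ∧
      |∫ z, G z.1 z.2 * f z.1 * g z.2
          ∂(volume.restrict upperHalf).prod (volume.restrict upperHalf)| ≤
        8 / (1 - 1 / p) * √(∫ y in upperHalf, |g y|) *
          √((∫ y in upperHalf, |g y| ^ p) ^ (1 / p)) *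
          ((∫ y in upperHalf, y.2 * f y) ^ (1 - 1 / p) * (∫ y in upperHalf, f y) ^ (1 / p)) := by
  obtain ⟨hm1, hm2⟩ := rpow_moment_bound hp hf0 hf hf2
  have hR := riesz_potential_bound hp Measure.restrict_le_self hg hgp
  have hp0 : 0 < p := by linarith
  have h1p : 1 / p < 1 := by rw [div_lt_one hp0]; exact hp
  have h1p' : 0 < 1 / p := by positivity
  set a : ℝ := 1 - 1 / p with ha_def
  have ha : 0 < a := by linarith
  have ha1 : a ≤ 1 := by linarith
  set μ := volume.restrict upperHalf
  set N := 8 * √(∫ y, |g y| ∂μ) * √((∫ y, |g y| ^ p ∂μ) ^ (1 / p))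
  have hN : 0 ≤ N := by positivity
  have hmeas : AEStronglyMeasurable (fun z : (ℝ × ℝ) × (ℝ × ℝ) => G z.1 z.2 * f z.1 * g z.2)
      (μ.prod μ) :=
    (measurable_G.aestronglyMeasurable.mul hf.aestronglyMeasurable.comp_fst).mul
      hg.aestronglyMeasurable.comp_snd
  have hmem : ∀ᵐ y ∂μ, y ∈ upperHalf := ae_restrict_mem measurableSet_upperHalf
  have hpt : ∀ x ∈ upperHalf, ∀ᵐ y ∂μ, ‖G x y * f x * g y‖ ≤
      1 / a * (x.2 ^ a * f x) * (dist x y ^ (-a) * |g y|) := by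
    intro x hx
    filter_upwards [hmem] with y hy
    rw [norm_mul, norm_mul, Real.norm_of_nonneg (G_nonneg hx hy), Real.norm_of_nonneg (hf0 x),
      Real.norm_eq_abs]
    calc _ ≤ 1 / a * x.2 ^ a * dist x y ^ (-a) * f x * |g y| := by
          have := hf0 x
          gcongr
          exact G_le_dist_rpow ha ha1 hx hy
      _ = _ := by ring
  have hsec : ∀ x ∈ upperHalf, Integrable (fun y => G x y * f x * g y) μ := by
    intro x hx
    refine ((hR x).1.const_mul (1 / a * (x.2 ^ a * f x))).mono' ?_ (hpt x hx)
    exact ((measurable_G.comp measurable_prodMk_left).mul_const _).aestronglyMeasurable.mul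
      hg.aestronglyMeasurable
  have hsecle : ∀ x ∈ upperHalf, ∫ y, ‖G x y * f x * g y‖ ∂μ ≤ N / a * (x.2 ^ a * f x) := by
    intro x hx
    have hx' : 0 < x.2 := hx
    refine (integral_mono_ae (hsec x hx).norm
      ((hR x).1.const_mul (1 / a * (x.2 ^ a * f x))) (hpt x hx)).trans ?_
    rw [integral_const_mul]
    have := hf0 x
    calc _ ≤ 1 / a * (x.2 ^ a * f x) * N := by gcongr; exact (hR x).2
      _ = _ := by ring
  have hout : ∀ᵐ x ∂μ, ∫ y, ‖G x y * f x * g y‖ ∂μ ≤ N / a * (x.2 ^ a * f x) := by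
    filter_upwards [hmem] with x hx using hsecle x hx
  have hnormint : Integrable (fun x => ∫ y, ‖G x y * f x * g y‖ ∂μ) μ := by
    refine (hm1.const_mul (N / a)).mono' hmeas.norm.integral_prod_right' ?_
    filter_upwards [hout] with x hx
    rwa [Real.norm_of_nonneg (integral_nonneg fun y => norm_nonneg _)]
  have hint : Integrable (fun z : (ℝ × ℝ) × (ℝ × ℝ) => G z.1 z.2 * f z.1 * g z.2)
      (μ.prod μ) := by
    refine (integrable_prod_iff hmeas).2 ⟨?_, hnormint⟩
    filter_upwards [hmem] with x hx using hsec x hx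
  refine ⟨hint, ?_⟩
  rw [← Real.norm_eq_abs]
  refine (norm_integral_le_integral_norm _).trans ?_
  rw [integral_prod _ hint.norm]
  refine (integral_mono_ae hnormint (hm1.const_mul (N / a)) hout).trans ?_
  rw [integral_const_mul]
  refine (mul_le_mul_of_nonneg_left hm2 (by positivity)).trans (le_of_eq ?_)
  simp only [N]
  ring

theorem energy_difference_bound (p : ℝ) (hp : 1 < p) :
    ∃ C : ℝ, 0 < C ∧ ∀ ω η : ℝ × ℝ → ℝ,
      (∀ y, 0 ≤ ω y) → (∀ y, 0 ≤ η y) →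
      IntegrableOn ω upperHalf → IntegrableOn (fun y => ω y ^ p) upperHalf →
      IntegrableOn (fun y => y.2 * ω y) upperHalf →
      IntegrableOn η upperHalf → IntegrableOn (fun y => η y ^ p) upperHalf →
      IntegrableOn (fun y => y.2 * η y) upperHalf →
      |energy ω - energy η| ≤
        C * (∫ y in upperHalf, |ω y - η y|) ^ (1/2 : ℝ) *
          ((∫ y in upperHalf, |ω y - η y| ^ p) ^ (1/p)) ^ (1/2 : ℝ) *
          (∫ y in upperHalf, y.2 * (ω y + η y)) ^ (1 - 1/p) *
          (∫ y in upperHalf, ω y + η y) ^ (1/p) := by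
  have hp0 : 0 < p := by linarith
  have h1p : 1 / p < 1 := by rw [div_lt_one hp0]; exact hp
  have ha : 0 < 1 - 1 / p := by linarith
  refine ⟨4 / (1 - 1 / p), by positivity, ?_⟩
  intro ω η hω0 hη0 hω hωp hω2 hη hηp hη2
  have hωp' : IntegrableOn (fun y => |ω y| ^ p) upperHalf := by
    simpa only [abs_of_nonneg (hω0 _)] using hωp
  have hηp' : IntegrableOn (fun y => |η y| ^ p) upperHalf := by
    simpa only [abs_of_nonneg (hη0 _)] using hηp
  have hdp : IntegrableOn (fun y => |ω y - η y| ^ p) upperHalf := by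
    refine Integrable.mono' (hωp.add hηp)
      ((hω.sub hη).abs.aestronglyMeasurable.aemeasurable.pow_const p).aestronglyMeasurable
      (.of_forall fun y => ?_)
    simp only [Pi.add_apply]
    rw [Real.norm_of_nonneg (Real.rpow_nonneg (abs_nonneg _) _)]
    have h1 := Real.rpow_nonneg (hω0 y) p
    have h2 := Real.rpow_nonneg (hη0 y) p
    rcases le_total (ω y) (η y) with h | h
    · have : |ω y - η y| ≤ η y := by rw [abs_le]; constructor <;> linarith [hω0 y, hη0 y]
      linarith [Real.rpow_le_rpow (abs_nonneg _) this hp0.le]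
    · have : |ω y - η y| ≤ ω y := by rw [abs_le]; constructor <;> linarith [hω0 y, hη0 y]
      linarith [Real.rpow_le_rpow (abs_nonneg _) this hp0.le]
  have hs2 : IntegrableOn (fun y => y.2 * (ω y + η y)) upperHalf := by
    simpa only [mul_add] using! hω2.add hη2
  have iωω := (bilinear_energy_bound hp hω0 hω hω2 hω hωp').1
  have iωη := (bilinear_energy_bound hp hω0 hω hω2 hη hηp').1
  have iηω := (bilinear_energy_bound hp hη0 hη hη2 hω hωp').1
  have iηη := (bilinear_energy_bound hp hη0 hη hη2 hη hηp').1
  have hbound := (bilinear_energy_bound hp (f := fun y => ω y + η y) (g := fun y => ω y - η y)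
    (fun y => add_nonneg (hω0 y) (hη0 y)) (hω.add hη) hs2 (hω.sub hη) hdp).2
  set μ := volume.restrict upperHalf
  have hswap : ∫ z, G z.1 z.2 * η z.1 * ω z.2 ∂μ.prod μ =
      ∫ z, G z.1 z.2 * ω z.1 * η z.2 ∂μ.prod μ := by
    rw [← integral_prod_swap]
    congr 1 with z
    rw [Prod.fst_swap, Prod.snd_swap, G_symm]
    ring
  have hexp : ∫ z, G z.1 z.2 * (ω z.1 + η z.1) * (ω z.2 - η z.2) ∂μ.prod μ =
      (∫ z, G z.1 z.2 * ω z.1 * ω z.2 ∂μ.prod μ) -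
        ∫ z, G z.1 z.2 * η z.1 * η z.2 ∂μ.prod μ := by
    have : ∀ z : (ℝ × ℝ) × (ℝ × ℝ), G z.1 z.2 * (ω z.1 + η z.1) * (ω z.2 - η z.2) =
        (G z.1 z.2 * ω z.1 * ω z.2 - G z.1 z.2 * η z.1 * η z.2) +
          (G z.1 z.2 * η z.1 * ω z.2 - G z.1 z.2 * ω z.1 * η z.2) := fun z => by ring
    simp only [this]
    rw [integral_add (by exact iωω.sub iηη) (by exact iηω.sub iωη), integral_sub iωω iηη, integral_sub iηω iωη,
      hswap, sub_self, add_zero]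
  have heq : energy ω - energy η =
      1 / 2 * ∫ z, G z.1 z.2 * (ω z.1 + η z.1) * (ω z.2 - η z.2) ∂μ.prod μ := by
    rw [hexp, integral_prod _ iωω, integral_prod _ iηη, mul_sub]
    rfl
  rw [heq, abs_mul, abs_of_pos (by norm_num : (0 : ℝ) < 1 / 2), ← Real.sqrt_eq_rpow,
    ← Real.sqrt_eq_rpow]
  refine (mul_le_mul_of_nonneg_left hbound (by norm_num)).trans (le_of_eq ?_)
  ring
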